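/- The quotient of the braid group B_3 = ⟨σ1, σ2 | σ1σ2σ1 = σ2σ1σ2⟩ by the normal closure of the set {σ1^4, σ2^4} is a finite group of order exactly 96. -/

import Mathlib

/-- The braid relator for `B₃ = ⟨σ1, σ2 | σ1σ2σ1 = σ2σ1σ2⟩`. -/
def braidRels : Set (FreeGroup (Fin 2)) :=
  {FreeGroup.of 0 * FreeGroup.of 1 * FreeGroup.of 0 *
    (FreeGroup.of 1 * FreeGroup.of 0 * FreeGroup.of 1)⁻¹}

/-- The braid group on three strands, as a presented group. -/
abbrev BraidGroup3 : Type := PresentedGroup braidRels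

/-- The generator σ1 of `B₃`. -/
def sigma1 : BraidGroup3 := PresentedGroup.of 0

/-- The generator σ2 of `B₃`. -/
def sigma2 : BraidGroup3 := PresentedGroup.of 1

section UpperBound

variable {G : Type*} [Group G] {a b : G}

/-- Representatives of the six right cosets of the subgroup generated by `a` and
`(a * b * a) ^ 2`. -/
def cosetRep (a b : G) : Fin 6 → G :=
  ![1, b, b * a, b * a ^ 2, b * a ^ 3, b ^ 2]

theorem commute_sq_left (h : a * b * a = b * a * b) : Commute ((a * b * a) ^ 2) a := by
  have h1 : a * b * a * a = b * (a * b * a) := by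
    nth_rw 1 [h]; simp only [mul_assoc]
  have h2 : a * b * a * b = a * (a * b * a) := by
    nth_rw 2 [h]; simp only [mul_assoc]
  rw [Commute, SemiconjBy, sq, mul_assoc, h1, ← mul_assoc, h2, mul_assoc]

theorem commute_sq_right (h : a * b * a = b * a * b) : Commute ((a * b * a) ^ 2) b := by
  rw [h]; exact commute_sq_left h.symm

theorem mul_sq_mul (h : a * b * a = b * a * b) :
    b * a ^ 2 * b = (a * b * a) ^ 2 * (a⁻¹ * a⁻¹) := by
  rw [← mul_assoc, (commute_sq_left h).inv_right.eq]
  simp only [sq, mul_assoc, inv_mul_cancel_left, mul_inv_cancel, mul_one]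

theorem sq_mul_eq (h : a * b * a = b * a * b) (ha : a ^ 4 = 1) :
    b ^ 2 * a = (a * b * a) ^ 2 * (a⁻¹ * b ^ 2) := by
  have h1 : b * a = a⁻¹ * b * a * b := by
    have : b * a = a⁻¹ * (a * b * a) := by group
    rw [this, h]; group
  have h2 : a⁻¹ * a⁻¹ = a ^ 2 := by
    rw [← mul_inv_rev, inv_eq_iff_mul_eq_one, ← ha]; group
  calc b ^ 2 * a = b * (b * a) := by simp only [sq, mul_assoc]
    _ = b * a⁻¹ * (b * a) * b := by nth_rw 1 [h1]; simp only [mul_assoc]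
    _ = b * (a⁻¹ * a⁻¹) * b * a * b * b := by nth_rw 1 [h1]; simp only [mul_assoc]
    _ = _ := by
      rw [h2, mul_sq_mul h]
      simp only [sq, mul_assoc, inv_mul_cancel_left]

theorem pow_four_sq_eq_one (h : a * b * a = b * a * b) (ha : a ^ 4 = 1) :
    ((a * b * a) ^ 2) ^ 4 = 1 := by
  have h1 : (a * b * a) ^ 2 * a⁻¹ = b ^ 2 * a * (b ^ 2)⁻¹ := by
    rw [sq_mul_eq h ha, ← mul_assoc, mul_inv_cancel_right]
  have h2 : ((a * b * a) ^ 2 * a⁻¹) ^ 4 = 1 := by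
    rw [h1, conj_pow, ha, mul_one, mul_inv_cancel]
  rwa [(commute_sq_left h).inv_right.mul_pow, inv_pow, ha, inv_one, mul_one] at h2

theorem exists_cosetRep_mul_left (h : a * b * a = b * a * b) (ha : a ^ 4 = 1) (k : Fin 6) :
    ∃ (m n : ℤ) (l : Fin 6),
      cosetRep a b k * a = ((a * b * a) ^ 2) ^ m * a ^ n * cosetRep a b l := by
  fin_cases k
  · exact ⟨0, 1, 0, by simp [cosetRep]⟩
  · exact ⟨0, 0, 2, by simp [cosetRep]⟩
  · exact ⟨0, 0, 3, by simp [cosetRep, sq, mul_assoc]⟩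
  · exact ⟨0, 0, 4, by simp [cosetRep, pow_succ, mul_assoc]⟩
  · exact ⟨0, 0, 1, by simp [cosetRep, mul_assoc, ← pow_succ, ha]⟩
  · exact ⟨1, -1, 5, by simpa [cosetRep, mul_assoc] using sq_mul_eq h ha⟩

theorem exists_cosetRep_mul_right (h : a * b * a = b * a * b) (ha : a ^ 4 = 1)
    (hb : b ^ 4 = 1) (k : Fin 6) :
    ∃ (m n : ℤ) (l : Fin 6),
      cosetRep a b k * b = ((a * b * a) ^ 2) ^ m * a ^ n * cosetRep a b l := by
  have hza := commute_sq_left h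
  have ha3 : a ^ 3 = a⁻¹ := eq_inv_of_mul_eq_one_left (by rw [← pow_succ, ha])
  have hb3 : b ^ 3 = b⁻¹ := eq_inv_of_mul_eq_one_left (by rw [← pow_succ, hb])
  have key := mul_sq_mul h
  have key' : b * a ^ 2 = (a * b * a) ^ 2 * (a⁻¹ * a⁻¹) * b⁻¹ := by
    rw [← key, mul_inv_cancel_right]
  fin_cases k
  · exact ⟨0, 0, 1, by simp [cosetRep]⟩
  · exact ⟨0, 0, 5, by simp [cosetRep, sq]⟩
  · exact ⟨0, 1, 2, by simp [cosetRep, ← h, mul_assoc]⟩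
  · change ∃ (m n : ℤ) (l : Fin 6),
      b * a ^ 2 * b = ((a * b * a) ^ 2) ^ m * a ^ n * cosetRep a b l
    exact ⟨1, -2, 0, by
      rw [key, ← mul_inv_rev, ← sq, zpow_one, zpow_neg, zpow_ofNat]
      exact (mul_one _).symm⟩
  · refine ⟨1, -1, 4, ?_⟩
    have h1 : b⁻¹ * (a * b) = a * b * a⁻¹ := by
      rw [inv_mul_eq_iff_eq_mul, ← mul_assoc, eq_mul_inv_iff_mul_eq, h, ← mul_assoc]
    calc b * a ^ 3 * b = b * a ^ 2 * (a * b) := by simp only [pow_succ, mul_assoc]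
      _ = (a * b * a) ^ 2 * (a⁻¹ * a⁻¹) * (b⁻¹ * (a * b)) := by
        rw [key']; simp only [mul_assoc]
      _ = (a * b * a) ^ 2 * a⁻¹ * (b * a⁻¹) := by
        rw [h1]; simp only [mul_assoc, inv_mul_cancel_left]
      _ = _ := by simp [cosetRep, ha3]
  · refine ⟨-1, 2, 3, ?_⟩
    calc b ^ 2 * b = b⁻¹ := by rw [← pow_succ, hb3]
      _ = a ^ 2 * (((a * b * a) ^ 2)⁻¹ * (b * a ^ 2)) := by
        rw [key']; simp only [sq a, mul_assoc, inv_mul_cancel_left, mul_inv_cancel_left]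
      _ = ((a * b * a) ^ 2)⁻¹ * a ^ 2 * (b * a ^ 2) := by
        rw [(hza.inv_left.pow_right 2).eq]; simp only [mul_assoc]
      _ = _ := by simp [cosetRep, zpow_ofNat]

theorem exists_eq_zpow_mul_cosetRep (h : a * b * a = b * a * b) (ha : a ^ 4 = 1)
    (hb : b ^ 4 = 1) (hgen : Subgroup.closure {a, b} = ⊤) (g : G) :
    ∃ (m n : ℤ) (k : Fin 6), g = ((a * b * a) ^ 2) ^ m * a ^ n * cosetRep a b k := by
  have step : ∀ x y : G,
      (∀ k, ∃ (m n : ℤ) (l : Fin 6),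
        cosetRep a b k * y = ((a * b * a) ^ 2) ^ m * a ^ n * cosetRep a b l) →
      (∃ (m n : ℤ) (k : Fin 6), x = ((a * b * a) ^ 2) ^ m * a ^ n * cosetRep a b k) →
      ∃ (m n : ℤ) (k : Fin 6), x * y = ((a * b * a) ^ 2) ^ m * a ^ n * cosetRep a b k := by
    rintro _ y hy ⟨m, n, k, rfl⟩
    obtain ⟨m', n', l, hl⟩ := hy k
    refine ⟨m + m', n + n', l, ?_⟩
    have hc := ((commute_sq_left h).zpow_zpow m' n).eq
    rw [mul_assoc, hl, zpow_add, zpow_add, ← mul_assoc, ← mul_assoc,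
      mul_assoc _ _ (_ ^ m'), ← hc]
    simp only [mul_assoc]
  have hinv : ∀ y : G, y ^ 4 = 1 → ∀ x, x * y⁻¹ = x * y * y * y := by
    intro y hy x
    rw [← eq_inv_of_mul_eq_one_left (a := y ^ 3) (b := y) (by rw [← pow_succ, hy])]
    simp only [pow_succ, pow_zero, one_mul, mul_assoc]
  have hA := fun x => step x a (exists_cosetRep_mul_left h ha)
  have hB := fun x => step x b (exists_cosetRep_mul_right h ha hb)
  have hg : g ∈ Subgroup.closure {a, b} := hgen ▸ Subgroup.mem_top g
  induction hg using Subgroup.closure_induction_right with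
  | one => exact ⟨0, 0, 0, by simp [cosetRep]⟩
  | mul_right x hx y hy ih =>
    rcases hy with rfl | rfl
    · exact hA _ ih
    · exact hB _ ih
  | mul_inv_cancel x hx y hy ih =>
    rcases hy with rfl | rfl
    · rw [hinv _ ha]; exact hA _ (hA _ (hA _ ih))
    · rw [hinv _ hb]; exact hB _ (hB _ (hB _ ih))

theorem exists_zpow_eq_pow_fin {x : G} (hx : x ^ 4 = 1) (m : ℤ) :
    ∃ i : Fin 4, x ^ m = x ^ (i : ℕ) := by
  have h0 : 0 ≤ m % 4 := Int.emod_nonneg _ (by norm_num)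
  have h4 : m % 4 < 4 := Int.emod_lt_of_pos _ (by norm_num)
  refine ⟨⟨(m % 4).toNat, by omega⟩, ?_⟩
  rw [← zpow_natCast, Int.toNat_of_nonneg h0]
  exact zpow_eq_zpow_emod m (by exact_mod_cast hx)

/-- The normal form `z ^ i * a ^ j * w` with `z = (a * b * a) ^ 2` and `w` a coset
representative. -/
def normalForm (a b : G) (p : Fin 4 × Fin 4 × Fin 6) : G :=
  ((a * b * a) ^ 2) ^ (p.1 : ℕ) * a ^ (p.2.1 : ℕ) * cosetRep a b p.2.2

theorem normalForm_surjective (h : a * b * a = b * a * b) (ha : a ^ 4 = 1)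
    (hb : b ^ 4 = 1) (hgen : Subgroup.closure {a, b} = ⊤) :
    Function.Surjective (normalForm a b) := by
  intro g
  obtain ⟨m, n, k, rfl⟩ := exists_eq_zpow_mul_cosetRep h ha hb hgen g
  obtain ⟨i, hi⟩ := exists_zpow_eq_pow_fin (pow_four_sq_eq_one h ha) m
  obtain ⟨j, hj⟩ := exists_zpow_eq_pow_fin ha n
  exact ⟨(i, j, k), by rw [normalForm, hi, hj]⟩

theorem map_normalForm {H : Type*} [Group H] (f : G →* H) (p : Fin 4 × Fin 4 × Fin 6) :
    f (normalForm a b p) = normalForm (f a) (f b) p := by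
  obtain ⟨i, j, k⟩ := p
  fin_cases k <;> simp [normalForm, cosetRep]

end UpperBound

section LowerBound

/-- The reduced Burau matrix of `σ1` over the field with five elements, at `t = 2`. -/
def burauOne : (Matrix (Fin 2) (Fin 2) (ZMod 5))ˣ :=
  ⟨!![3, 1; 0, 1], !![2, 3; 0, 1], by decide, by decide⟩

/-- The reduced Burau matrix of `σ2` over the field with five elements, at `t = 2`. -/
def burauTwo : (Matrix (Fin 2) (Fin 2) (ZMod 5))ˣ :=
  ⟨!![1, 0; 2, 3], !![1, 0; 1, 2], by decide, by decide⟩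

theorem burau_braid : burauOne * burauTwo * burauOne = burauTwo * burauOne * burauTwo := by
  decide +kernel

theorem burauOne_pow_four : burauOne ^ 4 = 1 := by decide +kernel

theorem burauTwo_pow_four : burauTwo ^ 4 = 1 := by decide +kernel

theorem normalForm_burau_injective : Function.Injective (normalForm burauOne burauTwo) := by
  decide +kernel

/-- The reduction modulo 5 of the Burau representation of `B₃`, at `t = 2`. -/
def burau : BraidGroup3 →* (Matrix (Fin 2) (Fin 2) (ZMod 5))ˣ :=
  PresentedGroup.toGroup (f := ![burauOne, burauTwo]) (by
    rintro r rfl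
    simp [burau_braid])

theorem burau_sigma1 : burau sigma1 = burauOne := PresentedGroup.toGroup.of _

theorem burau_sigma2 : burau sigma2 = burauTwo := PresentedGroup.toGroup.of _

end LowerBound

theorem sigma_braid : sigma1 * sigma2 * sigma1 = sigma2 * sigma1 * sigma2 := by
  rw [← mul_inv_eq_one]
  exact PresentedGroup.one_of_mem (rels := braidRels) rfl

theorem closure_sigma : Subgroup.closure {sigma1, sigma2} = ⊤ := by
  rw [← PresentedGroup.closure_range_of braidRels]
  congr 1
  ext x
  simp [Fin.exists_fin_two, sigma1, sigma2, eq_comm]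

/-- Coxeter's theorem: `B₃/(σ1⁴, σ2⁴)` is a finite group of order exactly 96. -/
theorem coxeter_B3_mod_fourth_powers :
    Finite (BraidGroup3 ⧸ Subgroup.normalClosure ({sigma1 ^ 4, sigma2 ^ 4} : Set BraidGroup3)) ∧
    Nat.card (BraidGroup3 ⧸ Subgroup.normalClosure ({sigma1 ^ 4, sigma2 ^ 4} : Set BraidGroup3))
      = 96 := by
  set N := Subgroup.normalClosure ({sigma1 ^ 4, sigma2 ^ 4} : Set BraidGroup3)
  let q := QuotientGroup.mk' N
  have h : q sigma1 * q sigma2 * q sigma1 = q sigma2 * q sigma1 * q sigma2 := by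
    simp only [← map_mul, sigma_braid]
  have h1 : q sigma1 ^ 4 = 1 := by
    rw [← map_pow]
    exact (QuotientGroup.eq_one_iff _).2 (Subgroup.subset_normalClosure (by simp))
  have h2 : q sigma2 ^ 4 = 1 := by
    rw [← map_pow]
    exact (QuotientGroup.eq_one_iff _).2 (Subgroup.subset_normalClosure (by simp))
  have hgen : Subgroup.closure {q sigma1, q sigma2} = ⊤ := by
    rw [← Set.image_pair, ← MonoidHom.map_closure, closure_sigma,
      Subgroup.map_top_of_surjective _ (QuotientGroup.mk'_surjective N)]
  have hsurj := normalForm_surjective h h1 h2 hgen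
  have hle : N ≤ burau.ker := by
    refine Subgroup.normalClosure_le_normal ?_
    rintro x (rfl | rfl)
    · simp [MonoidHom.mem_ker, burau_sigma1, burauOne_pow_four]
    · simp [MonoidHom.mem_ker, burau_sigma2, burauTwo_pow_four]
  let f := QuotientGroup.lift N burau hle
  have hf1 : f (q sigma1) = burauOne := burau_sigma1
  have hf2 : f (q sigma2) = burauTwo := burau_sigma2
  have hinj : Function.Injective (normalForm (q sigma1) (q sigma2)) := by
    refine Function.Injective.of_comp (f := f) ?_
    have : f ∘ normalForm (q sigma1) (q sigma2) = normalForm burauOne burauTwo := by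
      ext1 p
      rw [Function.comp_apply, map_normalForm, hf1, hf2]
    rw [this]
    exact normalForm_burau_injective
  refine ⟨Finite.of_surjective _ hsurj, ?_⟩
  rw [← Nat.card_eq_of_bijective _ ⟨hinj, hsurj⟩]
  simp
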